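/- Let α ∈ [0,∞)^d. There exists a constant C_α > 0, depending only on α and d, such that for every i = 1,…,d, every x, y ∈ ℝ_+^d and every t > 0, |∂_{x_i} 𝒲_t^α(x,y)| ≤ C_α ((x_i + y_i)/t^{1/2}) e^{−|x−y|²/(8t)} / t^{|α| + (d+1)/2}. -/

import Mathlib

open MeasureTheory Real Filter Set
open scoped ENNReal BigOperators

noncomputable section

/-- The open positive orthant `(0,∞)^d`. -/
def posOrth (d : ℕ) : Set (Fin d → ℝ) := {x | ∀ j, 0 < x j}

/-- The weighted measure `x^{2α} dx` on the positive orthant. -/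
def wMeasure (d : ℕ) (α : Fin d → ℝ) : Measure (Fin d → ℝ) :=
  (volume.restrict (posOrth d)).withDensity
    (fun x => ENNReal.ofReal (∏ j, (x j) ^ (2 * α j)))

/-- The Bessel function of the first kind of order `μ`. -/
def besselJ (μ : ℝ) (z : ℝ) : ℝ :=
  ∑' k : ℕ, ((-1 : ℝ) ^ k / ((k.factorial : ℝ) * Real.Gamma ((k : ℝ) + μ + 1))) *
    (z / 2) ^ (2 * (k : ℝ) + μ)

/-- The modified Bessel function of the first kind of order `μ`. -/
def besselI (μ : ℝ) (z : ℝ) : ℝ :=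
  ∑' k : ℕ, (1 / ((k.factorial : ℝ) * Real.Gamma ((k : ℝ) + μ + 1))) *
    (z / 2) ^ (2 * (k : ℝ) + μ)

/-- The eigenfunctions `φ_y^α(x) = ∏_j (x_j y_j)^{-α_j+1/2} J_{α_j-1/2}(x_j y_j)`. -/
def phiFn (d : ℕ) (α : Fin d → ℝ) (y x : Fin d → ℝ) : ℝ :=
  ∏ j, ((x j * y j) ^ (-(α j) + 1 / 2) * besselJ (α j - 1 / 2) (x j * y j))

/-- The Hankel transform `h_α f(x) = ∫ φ_y^α(x) f(y) y^{2α} dy`. -/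
def hankel (d : ℕ) (α : Fin d → ℝ) (f : (Fin d → ℝ) → ℝ) (x : Fin d → ℝ) : ℝ :=
  ∫ y, phiFn d α y x * f y ∂(wMeasure d α)

/-- The Euclidean norm on `Fin d → ℝ`. -/
def eNorm (d : ℕ) (x : Fin d → ℝ) : ℝ := Real.sqrt (∑ j, (x j) ^ 2)

/-- The `i`-th Bessel–Riesz transform
`R_{α,i} f(x) = -x_i h_{α+e_i}((1/|y|) h_α f(y))(x)`. -/
def riesz (d : ℕ) (α : Fin d → ℝ) (i : Fin d) (f : (Fin d → ℝ) → ℝ)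
    (x : Fin d → ℝ) : ℝ :=
  -(x i) * hankel d (α + Pi.single i 1) (fun y => (1 / eNorm d y) * hankel d α f y) x

/-- The Bessel–Poisson semigroup `P_t^α f = h_α(e^{-|·|t} h_α f)`. -/
def poissonH (d : ℕ) (α : Fin d → ℝ) (t : ℝ) (f : (Fin d → ℝ) → ℝ) :
    (Fin d → ℝ) → ℝ :=
  hankel d α (fun y => Real.exp (-(eNorm d y) * t) * hankel d α f y)

/-- The `i`-th conjugate Poisson semigroup
`ℙ_t^{α,i} g(x) = x_i h_{α+e_i}(e^{-|y|t} h_{α+e_i}(g(·)/·_i)(y))(x)`. -/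
def conjPoissonH (d : ℕ) (α : Fin d → ℝ) (i : Fin d) (t : ℝ)
    (g : (Fin d → ℝ) → ℝ) (x : Fin d → ℝ) : ℝ :=
  x i * hankel d (α + Pi.single i 1)
    (fun y => Real.exp (-(eNorm d y) * t) *
      hankel d (α + Pi.single i 1) (fun z => g z / z i) y) x

/-- The Bessel heat kernel `𝒲_t^α(x,y)`. -/
def heatK (d : ℕ) (α : Fin d → ℝ) (t : ℝ) (x y : Fin d → ℝ) : ℝ :=
  (2 * t) ^ (-(∑ j, α j) - (d : ℝ) / 2) *
    Real.exp (-((eNorm d x) ^ 2 + (eNorm d y) ^ 2) / (4 * t)) *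
    ∏ j, ((x j * y j / (2 * t)) ^ (-(α j) + 1 / 2) *
      besselI (α j - 1 / 2) (x j * y j / (2 * t)))

/-- The Bessel–Poisson kernel `𝒫_t^α(x,y)` obtained by subordination. -/
def poissonK (d : ℕ) (α : Fin d → ℝ) (t : ℝ) (x y : Fin d → ℝ) : ℝ :=
  (t / Real.sqrt (2 * Real.pi)) *
    ∫ u in Set.Ioi (0 : ℝ),
      u ^ (-(3 : ℝ) / 2) * Real.exp (-(t ^ 2) / (4 * u)) * heatK d α u x y

/-- The Poisson semigroup defined through the Poisson kernel. -/
def poissonOp (d : ℕ) (α : Fin d → ℝ) (t : ℝ) (f : (Fin d → ℝ) → ℝ)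
    (x : Fin d → ℝ) : ℝ :=
  ∫ y, poissonK d α t x y * f y ∂(wMeasure d α)

/-- The partial derivative in the `i`-th coordinate. -/
def pd (d : ℕ) (i : Fin d) (F : (Fin d → ℝ) → ℝ) (x : Fin d → ℝ) : ℝ :=
  deriv (fun s => F (Function.update x i s)) (x i)

/-- Smooth compactly supported functions on `(0,∞)^d`. -/
def CcInfPos (d : ℕ) (f : (Fin d → ℝ) → ℝ) : Prop :=
  ContDiff ℝ (⊤ : ℕ∞) f ∧ HasCompactSupport f ∧ tsupport f ⊆ posOrth d

/-- The Taylor coefficient of `z ^ (2 * k)` in `z ^ (-a + 1 / 2) * besselI (a - 1 / 2) z`. -/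
def besselCoeff (a : ℝ) (k : ℕ) : ℝ :=
  (2 : ℝ) ^ (1 / 2 - a) / (4 ^ k * (k.factorial : ℝ) * Real.Gamma ((k : ℝ) + a + 1 / 2))

/-- The entire function `z ^ (-a + 1 / 2) * besselI (a - 1 / 2) z`. -/
def besselG (a z : ℝ) : ℝ := ∑' k : ℕ, besselCoeff a k * z ^ (2 * k)

/-- The termwise derivative of `besselG`. -/
def besselGDeriv (a z : ℝ) : ℝ :=
  ∑' k : ℕ, besselCoeff a k * ((2 * k : ℕ) * z ^ (2 * k - 1))

/-- The constant in the exponential bounds for `besselG` and its derivative. -/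
def besselConst (a : ℝ) : ℝ := (2 : ℝ) ^ (1 / 2 - a) / Real.Gamma (a + 1 / 2)

lemma besselConst_pos {a : ℝ} (ha : 0 ≤ a) : 0 < besselConst a :=
  div_pos (by positivity) (Real.Gamma_pos_of_pos (by linarith))

lemma besselCoeff_nonneg {a : ℝ} (ha : 0 ≤ a) (k : ℕ) : 0 ≤ besselCoeff a k := by
  have := Real.Gamma_pos_of_pos (show (0 : ℝ) < (k : ℝ) + a + 1 / 2 by positivity)
  unfold besselCoeff
  positivity

lemma factorial_two_mul_mul_Gamma_le {a : ℝ} (ha : 0 ≤ a) (k : ℕ) :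
    Real.Gamma (a + 1 / 2) * ((2 * k).factorial : ℝ) ≤
      4 ^ k * (k.factorial : ℝ) * Real.Gamma ((k : ℝ) + a + 1 / 2) := by
  induction k with
  | zero => simp
  | succ k ih =>
    have hpos : (0 : ℝ) < (k : ℝ) + a + 1 / 2 := by positivity
    have hG := Real.Gamma_pos_of_pos hpos
    have h1 : Real.Gamma (((k + 1 : ℕ) : ℝ) + a + 1 / 2) =
        ((k : ℝ) + a + 1 / 2) * Real.Gamma ((k : ℝ) + a + 1 / 2) := by
      rw [← Real.Gamma_add_one hpos.ne']
      congr 1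
      push_cast
      ring
    have h2 : ((2 * (k + 1)).factorial : ℝ) =
        (2 * k + 2) * (2 * k + 1) * ((2 * k).factorial : ℝ) := by
      rw [show 2 * (k + 1) = 2 * k + 1 + 1 by ring, Nat.factorial_succ, Nat.factorial_succ]
      push_cast
      ring
    rw [h1, h2, Nat.factorial_succ]
    calc Real.Gamma (a + 1 / 2) * ((2 * k + 2) * (2 * k + 1) * ((2 * k).factorial : ℝ))
        = ((2 * k + 2) * (2 * k + 1)) * (Real.Gamma (a + 1 / 2) * ((2 * k).factorial : ℝ)) := by
          ring
      _ ≤ ((2 * k + 2) * (2 * (k + a + 1 / 2))) *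
          (4 ^ k * (k.factorial : ℝ) * Real.Gamma ((k : ℝ) + a + 1 / 2)) := by
          have hGa := Real.Gamma_pos_of_pos (show (0 : ℝ) < a + 1 / 2 by linarith)
          gcongr
          linarith
      _ = _ := by
          push_cast
          ring

lemma besselCoeff_le {a : ℝ} (ha : 0 ≤ a) (k : ℕ) :
    besselCoeff a k ≤ besselConst a / ((2 * k).factorial : ℝ) := by
  have hG := Real.Gamma_pos_of_pos (show (0 : ℝ) < a + 1 / 2 by linarith)
  unfold besselCoeff besselConst
  rw [div_div]
  exact div_le_div_of_nonneg_left (by positivity) (by positivity)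
    (factorial_two_mul_mul_Gamma_le ha k)

lemma summable_and_tsum_pow_div_factorial_comp_le {e : ℕ → ℕ} (he : Function.Injective e)
    {z : ℝ} (hz : 0 ≤ z) :
    Summable (fun k => z ^ e k / ((e k).factorial : ℝ)) ∧
      ∑' k, z ^ e k / ((e k).factorial : ℝ) ≤ Real.exp z := by
  have hs := Real.summable_pow_div_factorial z
  have hs' : Summable (fun k => z ^ e k / ((e k).factorial : ℝ)) := hs.comp_injective he
  refine ⟨hs', ?_⟩
  rw [Real.exp_eq_exp_ℝ, NormedSpace.exp_eq_tsum_div]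
  exact hs'.tsum_le_tsum_of_inj e he (fun n _ => by positivity) (fun _ => le_rfl) hs

lemma two_mul_injective : Function.Injective (fun k : ℕ => 2 * k) := fun m n h => by
  simp only at h
  omega

lemma two_mul_sub_one_injective : Function.Injective (fun k : ℕ => 2 * k - 1) := fun m n h => by
  simp only at h
  omega

lemma besselCoeff_mul_pow_le {a z : ℝ} (ha : 0 ≤ a) (hz : 0 ≤ z) (k : ℕ) :
    besselCoeff a k * z ^ (2 * k) ≤ besselConst a * (z ^ (2 * k) / ((2 * k).factorial : ℝ)) := by
  calc besselCoeff a k * z ^ (2 * k)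
      ≤ besselConst a / ((2 * k).factorial : ℝ) * z ^ (2 * k) := by
        gcongr
        exact besselCoeff_le ha k
    _ = _ := by ring

lemma besselCoeff_mul_deriv_pow_le {a z : ℝ} (ha : 0 ≤ a) (hz : 0 ≤ z) (k : ℕ) :
    besselCoeff a k * ((2 * k : ℕ) * z ^ (2 * k - 1)) ≤
      besselConst a * (z ^ (2 * k - 1) / ((2 * k - 1).factorial : ℝ)) := by
  have hK := besselConst_pos ha
  rcases k with _ | k
  · simp [hK.le]
  · have h : ((2 * (k + 1)).factorial : ℝ) =
        ((2 * (k + 1) : ℕ) : ℝ) * ((2 * (k + 1) - 1).factorial : ℝ) := by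
      rw [← Nat.cast_mul, Nat.mul_factorial_pred (by omega)]
    calc _ ≤ besselConst a / ((2 * (k + 1)).factorial : ℝ) *
          ((2 * (k + 1) : ℕ) * z ^ (2 * (k + 1) - 1)) := by
          gcongr
          exact besselCoeff_le ha _
      _ = _ := by
          rw [h]
          field_simp

lemma summable_besselG {a z : ℝ} (ha : 0 ≤ a) (hz : 0 ≤ z) :
    Summable (fun k : ℕ => besselCoeff a k * z ^ (2 * k)) :=
  Summable.of_nonneg_of_le (fun k => mul_nonneg (besselCoeff_nonneg ha k) (by positivity))
    (besselCoeff_mul_pow_le ha hz)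
    ((summable_and_tsum_pow_div_factorial_comp_le two_mul_injective hz).1.mul_left _)

lemma summable_besselGDeriv {a z : ℝ} (ha : 0 ≤ a) (hz : 0 ≤ z) :
    Summable (fun k : ℕ => besselCoeff a k * ((2 * k : ℕ) * z ^ (2 * k - 1))) :=
  Summable.of_nonneg_of_le (fun k => mul_nonneg (besselCoeff_nonneg ha k) (by positivity))
    (besselCoeff_mul_deriv_pow_le ha hz)
    ((summable_and_tsum_pow_div_factorial_comp_le two_mul_sub_one_injective hz).1.mul_left _)

lemma besselG_nonneg {a z : ℝ} (ha : 0 ≤ a) (hz : 0 ≤ z) : 0 ≤ besselG a z :=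
  tsum_nonneg fun k => mul_nonneg (besselCoeff_nonneg ha k) (by positivity)

lemma besselGDeriv_nonneg {a z : ℝ} (ha : 0 ≤ a) (hz : 0 ≤ z) : 0 ≤ besselGDeriv a z :=
  tsum_nonneg fun k => mul_nonneg (besselCoeff_nonneg ha k) (by positivity)

lemma besselG_le {a z : ℝ} (ha : 0 ≤ a) (hz : 0 ≤ z) :
    besselG a z ≤ besselConst a * Real.exp z := by
  obtain ⟨hs, hle⟩ := summable_and_tsum_pow_div_factorial_comp_le two_mul_injective hz
  calc besselG a z ≤ ∑' k : ℕ, besselConst a * (z ^ (2 * k) / ((2 * k).factorial : ℝ)) :=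
        (summable_besselG ha hz).tsum_le_tsum (besselCoeff_mul_pow_le ha hz) (hs.mul_left _)
    _ ≤ _ := by
        rw [tsum_mul_left]
        exact mul_le_mul_of_nonneg_left hle (besselConst_pos ha).le

lemma besselGDeriv_le {a z : ℝ} (ha : 0 ≤ a) (hz : 0 ≤ z) :
    besselGDeriv a z ≤ besselConst a * Real.exp z := by
  obtain ⟨hs, hle⟩ := summable_and_tsum_pow_div_factorial_comp_le two_mul_sub_one_injective hz
  calc besselGDeriv a z
      ≤ ∑' k : ℕ, besselConst a * (z ^ (2 * k - 1) / ((2 * k - 1).factorial : ℝ)) :=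
        (summable_besselGDeriv ha hz).tsum_le_tsum
          (besselCoeff_mul_deriv_pow_le ha hz) (hs.mul_left _)
    _ ≤ _ := by
        rw [tsum_mul_left]
        exact mul_le_mul_of_nonneg_left hle (besselConst_pos ha).le

lemma hasDerivAt_besselG {a z : ℝ} (ha : 0 ≤ a) (hz : 0 ≤ z) :
    HasDerivAt (besselG a) (besselGDeriv a z) z := by
  have hz1 : (0 : ℝ) ≤ z + 1 := by linarith
  have hmem : z ∈ Metric.ball (0 : ℝ) (z + 1) := by
    rw [mem_ball_zero_iff, Real.norm_of_nonneg hz]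
    linarith
  refine hasDerivAt_tsum_of_isPreconnected (summable_besselGDeriv ha hz1) Metric.isOpen_ball
    (convex_ball (0 : ℝ) (z + 1)).isPreconnected
    (fun k w _ => (hasDerivAt_pow (2 * k) w).const_mul (besselCoeff a k))
    (fun k w hw => ?_) hmem (summable_besselG ha hz) hmem
  rw [mem_ball_zero_iff] at hw
  rw [norm_mul, norm_mul, norm_pow, Real.norm_of_nonneg (besselCoeff_nonneg ha k),
    Real.norm_of_nonneg (Nat.cast_nonneg _)]
  have := besselCoeff_nonneg ha k
  gcongr

lemma rpow_mul_besselI {a z : ℝ} (hz : 0 < z) :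
    z ^ (-a + 1 / 2) * besselI (a - 1 / 2) z = besselG a z := by
  unfold besselI besselG
  rw [← tsum_mul_left]
  refine tsum_congr fun k => ?_
  have h1 : z ^ (2 * k) = z ^ (-a + 1 / 2) * z ^ (2 * (k : ℝ) + (a - 1 / 2)) := by
    rw [← Real.rpow_add hz, ← Real.rpow_natCast]
    congr 1
    push_cast
    ring
  have h2 : (2 : ℝ) ^ (2 * (k : ℝ) + (a - 1 / 2)) = 4 ^ k * (2 ^ (1 / 2 - a))⁻¹ := by
    rw [Real.rpow_add two_pos, Real.rpow_mul two_pos.le, Real.rpow_natCast,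
      ← Real.rpow_neg two_pos.le]
    norm_num
  rw [h1, Real.div_rpow hz.le two_pos.le, h2, besselCoeff,
    show (k : ℝ) + (a - 1 / 2) + 1 = k + a + 1 / 2 by ring]
  have : (2 : ℝ) ^ (1 / 2 - a) ≠ 0 := by positivity
  simp only [div_eq_mul_inv, mul_inv, inv_inv]
  ring

/-- The one-dimensional Bessel heat kernel without its power of time. -/
def heatFactor (a t u v : ℝ) : ℝ :=
  Real.exp (-(u ^ 2 + v ^ 2) / (4 * t)) * besselG a (u * v / (2 * t))

lemma exp_mul_exp_eq {t : ℝ} (ht : 0 < t) (u v : ℝ) :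
    Real.exp (-(u ^ 2 + v ^ 2) / (4 * t)) * Real.exp (u * v / (2 * t)) =
      Real.exp (-(u - v) ^ 2 / (4 * t)) := by
  rw [← Real.exp_add]
  congr 1
  field_simp
  ring

lemma heatFactor_nonneg {a t u v : ℝ} (ha : 0 ≤ a) (ht : 0 < t) (hu : 0 ≤ u) (hv : 0 ≤ v) :
    0 ≤ heatFactor a t u v :=
  mul_nonneg (Real.exp_pos _).le (besselG_nonneg ha (by positivity))

lemma heatFactor_le {a t u v : ℝ} (ha : 0 ≤ a) (ht : 0 < t) (hu : 0 ≤ u) (hv : 0 ≤ v) :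
    heatFactor a t u v ≤ besselConst a * Real.exp (-(u - v) ^ 2 / (4 * t)) := by
  rw [← exp_mul_exp_eq ht, heatFactor, mul_left_comm]
  gcongr
  exact besselG_le ha (by positivity)

lemma exists_hasDerivAt_heatFactor {a t u v : ℝ} (ha : 0 ≤ a) (ht : 0 < t)
    (hu : 0 ≤ u) (hv : 0 ≤ v) :
    ∃ D, HasDerivAt (fun s => heatFactor a t s v) D u ∧
      |D| ≤ (u + v) / t * (besselConst a * Real.exp (-(u - v) ^ 2 / (4 * t))) := by
  have hw : 0 ≤ u * v / (2 * t) := by positivity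
  have hE : HasDerivAt (fun s => Real.exp (-(s ^ 2 + v ^ 2) / (4 * t)))
      (Real.exp (-(u ^ 2 + v ^ 2) / (4 * t)) * (-(2 * u) / (4 * t))) u := by
    have := ((((hasDerivAt_pow 2 u).add_const (v ^ 2)).neg).div_const (4 * t)).exp
    simpa using this
  have hG : HasDerivAt (fun s => besselG a (s * v / (2 * t)))
      (besselGDeriv a (u * v / (2 * t)) * (1 * v / (2 * t))) u :=
    HasDerivAt.comp (h₂ := besselG a) (h := fun s => s * v / (2 * t)) u
      (hasDerivAt_besselG ha hw) (((hasDerivAt_id' u).mul_const v).div_const (2 * t))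
  refine ⟨_, hE.mul hG, ?_⟩
  rw [← exp_mul_exp_eq ht]
  set E := Real.exp (-(u ^ 2 + v ^ 2) / (4 * t))
  have hE0 : 0 < E := Real.exp_pos _
  have h1 := besselG_le ha hw
  have h2 := besselGDeriv_le ha hw
  have h3 := besselG_nonneg ha hw
  have h4 := besselGDeriv_nonneg ha hw
  set M := besselConst a * Real.exp (u * v / (2 * t)) with hM
  have hM0 : 0 ≤ M := h3.trans h1
  set G := besselG a (u * v / (2 * t))
  set G' := besselGDeriv a (u * v / (2 * t))
  have e1 : E * (-(2 * u) / (4 * t)) * G + E * (G' * (1 * v / (2 * t))) =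
      E * (v / (2 * t) * G') - E * (u / (2 * t) * G) := by
    field_simp
    ring
  have e2 : (u + v) / t * (besselConst a * (E * Real.exp (u * v / (2 * t)))) =
      2 * (E * (v / (2 * t) * M)) + 2 * (E * (u / (2 * t) * M)) := by
    rw [hM]
    field_simp
    ring
  have b1 : E * (v / (2 * t) * G') ≤ E * (v / (2 * t) * M) := by gcongr
  have b2 : E * (u / (2 * t) * G) ≤ E * (u / (2 * t) * M) := by gcongr
  have b3 : 0 ≤ E * (v / (2 * t) * G') := by positivity
  have b4 : 0 ≤ E * (u / (2 * t) * G) := by positivity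
  rw [e1, e2, abs_le]
  constructor <;> linarith

lemma heatK_eq_prod_heatFactor {d : ℕ} {α : Fin d → ℝ} {t : ℝ} (ht : 0 < t)
    {x y : Fin d → ℝ} (hx : x ∈ posOrth d) (hy : y ∈ posOrth d) :
    heatK d α t x y =
      (2 * t) ^ (-(∑ j, α j) - (d : ℝ) / 2) * ∏ j, heatFactor (α j) t (x j) (y j) := by
  have h : ∀ j, (x j * y j / (2 * t)) ^ (-(α j) + 1 / 2) *
      besselI (α j - 1 / 2) (x j * y j / (2 * t)) = besselG (α j) (x j * y j / (2 * t)) :=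
    fun j => rpow_mul_besselI (div_pos (mul_pos (hx j) (hy j)) (by positivity))
  unfold heatK heatFactor eNorm
  simp only [h]
  rw [Finset.prod_mul_distrib, ← Real.exp_sum, Real.sq_sqrt (by positivity),
    Real.sq_sqrt (by positivity), mul_assoc, ← Finset.sum_add_distrib, ← Finset.sum_div,
    ← Finset.sum_neg_distrib (f := fun j => x j ^ 2 + y j ^ 2)]

lemma exists_pd_heatK_eq {d : ℕ} {α : Fin d → ℝ} (hα : ∀ j, 0 ≤ α j) (i : Fin d)
    {x y : Fin d → ℝ} (hx : x ∈ posOrth d) (hy : y ∈ posOrth d) {t : ℝ} (ht : 0 < t) :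
    ∃ D, pd d i (fun z => heatK d α t z y) x =
        (2 * t) ^ (-(∑ j, α j) - (d : ℝ) / 2) *
          (D * ∏ j ∈ Finset.univ.erase i, heatFactor (α j) t (x j) (y j)) ∧
      |D| ≤ (x i + y i) / t *
        (besselConst (α i) * Real.exp (-(x i - y i) ^ 2 / (4 * t))) := by
  obtain ⟨D, hD, hDle⟩ := exists_hasDerivAt_heatFactor (hα i) ht (hx i).le (hy i).le
  refine ⟨D, ?_, hDle⟩
  refine HasDerivAt.deriv (HasDerivAt.congr_of_eventuallyEq
    ((hD.mul_const (∏ j ∈ Finset.univ.erase i, heatFactor (α j) t (x j) (y j))).const_mul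
      ((2 * t) ^ (-(∑ j, α j) - (d : ℝ) / 2))) ?_)
  filter_upwards [lt_mem_nhds (hx i)] with s hs
  have hmem : Function.update x i s ∈ posOrth d := fun j => by
    rcases eq_or_ne j i with rfl | hj
    · simpa using hs
    · simpa [hj] using hx j
  rw [heatK_eq_prod_heatFactor ht hmem hy, ← Finset.mul_prod_erase _ _ (Finset.mem_univ i)]
  simp only [Function.update_self]
  congr 2
  refine Finset.prod_congr rfl fun j hj => ?_
  rw [Function.update_of_ne (Finset.ne_of_mem_erase hj)]

/-- Gaussian upper bound for the gradient of the Bessel heat kernel. -/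
theorem heat_kernel_deriv_estimate (d : ℕ) (α : Fin d → ℝ)
    (hα : ∀ j, 0 ≤ α j) :
    ∃ C > (0 : ℝ), ∀ i : Fin d, ∀ x ∈ posOrth d, ∀ y ∈ posOrth d, ∀ t > (0 : ℝ),
      |pd d i (fun z => heatK d α t z y) x| ≤
        C * ((x i + y i) / Real.sqrt t) *
          (Real.exp (-(∑ j, (x j - y j) ^ 2) / (8 * t)) /
            t ^ ((∑ j, α j) + ((d : ℝ) + 1) / 2)) := by
  refine ⟨2 ^ (-(∑ j, α j) - (d : ℝ) / 2) * ∏ j, besselConst (α j),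
    mul_pos (by positivity) (Finset.prod_pos fun j _ => besselConst_pos (hα j)), ?_⟩
  intro i x hx y hy t ht
  obtain ⟨D, hpd, hD⟩ := exists_pd_heatK_eq hα i hx hy ht
  have hxi := hx i
  have hyi := hy i
  have hK : 0 < ∏ j, besselConst (α j) := Finset.prod_pos fun j _ => besselConst_pos (hα j)
  have hprod : |D * ∏ j ∈ Finset.univ.erase i, heatFactor (α j) t (x j) (y j)| ≤
      (x i + y i) / t *
        ((∏ j, besselConst (α j)) * Real.exp (-(∑ j, (x j - y j) ^ 2) / (8 * t))) := by
    have h0 : ∀ j ∈ Finset.univ.erase i, 0 ≤ heatFactor (α j) t (x j) (y j) :=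
      fun j _ => heatFactor_nonneg (hα j) ht (hx j).le (hy j).le
    rw [abs_mul, abs_of_nonneg (Finset.prod_nonneg h0)]
    calc _ ≤ (x i + y i) / t *
            (besselConst (α i) * Real.exp (-(x i - y i) ^ 2 / (4 * t))) *
          ∏ j ∈ Finset.univ.erase i,
            besselConst (α j) * Real.exp (-(x j - y j) ^ 2 / (4 * t)) :=
          mul_le_mul hD
            (Finset.prod_le_prod h0 fun j _ => heatFactor_le (hα j) ht (hx j).le (hy j).le)
            (Finset.prod_nonneg h0) ((abs_nonneg D).trans hD)
      _ = (x i + y i) / t *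
            ((∏ j, besselConst (α j)) * Real.exp (-(∑ j, (x j - y j) ^ 2) / (4 * t))) := by
          rw [mul_assoc, Finset.mul_prod_erase Finset.univ
            (fun j => besselConst (α j) * Real.exp (-(x j - y j) ^ 2 / (4 * t)))
            (Finset.mem_univ i), Finset.prod_mul_distrib, ← Real.exp_sum,
            ← Finset.sum_neg_distrib, Finset.sum_div]
      _ ≤ _ := by
          have hS : 0 ≤ ∑ j, (x j - y j) ^ 2 := Finset.sum_nonneg fun j _ => sq_nonneg _
          gcongr ?_ * (_ * Real.exp ?_)
          rw [neg_div, neg_div, neg_le_neg_iff]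
          gcongr
          norm_num
  have htpow : t ^ ((∑ j, α j) + ((d : ℝ) + 1) / 2) * Real.sqrt t =
      (t ^ (-(∑ j, α j) - (d : ℝ) / 2))⁻¹ * t := by
    rw [Real.sqrt_eq_rpow, ← Real.rpow_add ht, ← Real.rpow_neg ht.le, ← Real.rpow_add_one ht.ne']
    congr 1
    ring
  rw [hpd, abs_mul, abs_of_pos (by positivity)]
  refine (mul_le_mul_of_nonneg_left hprod (by positivity)).trans_eq ?_
  rw [Real.mul_rpow two_pos.le ht.le]
  have e : ∀ A B E : ℝ, A * (B / Real.sqrt t) *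
      (E / t ^ ((∑ j, α j) + ((d : ℝ) + 1) / 2)) =
      A * B * E / (t ^ ((∑ j, α j) + ((d : ℝ) + 1) / 2) * Real.sqrt t) := fun A B E => by
    field_simp
  rw [e, htpow]
  have : t ^ (-(∑ j, α j) - (d : ℝ) / 2) ≠ 0 := by positivity
  field_simp
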